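/- For every positive integer n, n! = Σ_{λ ⊢ n} f_λ², where the sum runs over all partitions λ of n and f_λ is the number of standard Young tableaux of shape λ. -/

import Mathlib

/-- A standard Young tableau of shape `μ`, encoded as a function on cells
(`0` outside the diagram) which is a bijection from the cells of `μ` onto
`{1, …, μ.card}` and strictly increases along rows and along columns. -/
def IsSYT (μ : YoungDiagram) (T : ℕ × ℕ → ℕ) : Prop :=
  Set.BijOn T (μ.cells : Set (ℕ × ℕ)) (Set.Icc 1 μ.card) ∧
  (∀ i j1 j2 : ℕ, j1 < j2 → (i, j2) ∈ μ → T (i, j1) < T (i, j2)) ∧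
  (∀ i1 i2 j : ℕ, i1 < i2 → (i2, j) ∈ μ → T (i1, j) < T (i2, j)) ∧
  (∀ c : ℕ × ℕ, c ∉ μ → T c = 0)

/-- `f_μ`, the number of standard Young tableaux of shape `μ`. -/
noncomputable def sytCard (μ : YoungDiagram) : ℕ :=
  Nat.card {T : ℕ × ℕ → ℕ // IsSYT μ T}

namespace YoungDiagram

theorem cells_subset_range_product (μ : YoungDiagram) :
    μ.cells ⊆ Finset.range μ.card ×ˢ Finset.range μ.card := by
  rintro ⟨i, j⟩ h
  have hcol : (Finset.range (i + 1)).image (fun k ↦ (k, j)) ⊆ μ.cells := by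
    intro c hc
    obtain ⟨k, hk, rfl⟩ := Finset.mem_image.1 hc
    exact μ.up_left_mem (Nat.lt_succ_iff.1 (Finset.mem_range.1 hk)) le_rfl h
  have hrow : (Finset.range (j + 1)).image (fun k ↦ (i, k)) ⊆ μ.cells := by
    intro c hc
    obtain ⟨k, hk, rfl⟩ := Finset.mem_image.1 hc
    exact μ.up_left_mem le_rfl (Nat.lt_succ_iff.1 (Finset.mem_range.1 hk)) h
  have h₁ := Finset.card_le_card hcol
  have h₂ := Finset.card_le_card hrow
  rw [Finset.card_image_of_injective _ (fun a b hab ↦ by simpa using hab),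
    Finset.card_range] at h₁ h₂
  simp only [Finset.mem_product, Finset.mem_range]
  exact ⟨h₁, h₂⟩

theorem finite_setOf_card_eq (n : ℕ) : {μ : YoungDiagram | μ.card = n}.Finite := by
  refine Set.Finite.of_finite_image (f := YoungDiagram.cells)
    ((Finset.range n ×ˢ Finset.range n).powerset.finite_toSet.subset ?_)
    (fun μ _ ν _ h ↦ YoungDiagram.ext h)
  rintro _ ⟨μ, rfl, rfl⟩
  exact Finset.mem_coe.2 (Finset.mem_powerset.2 μ.cells_subset_range_product)

/-- The finite set of Young diagrams with `n` cells. -/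
noncomputable def level (n : ℕ) : Finset YoungDiagram :=
  (finite_setOf_card_eq n).toFinset

@[simp]
theorem mem_level {n : ℕ} {μ : YoungDiagram} : μ ∈ level n ↔ μ.card = n := by
  simp [level]

open Classical in
/-- The Young diagrams obtained from `μ` by adding one cell. -/
noncomputable def up (μ : YoungDiagram) : Finset YoungDiagram :=
  (level (μ.card + 1)).filter (μ ≤ ·)

open Classical in
/-- The Young diagrams obtained from `μ` by removing one cell. -/
noncomputable def down (μ : YoungDiagram) : Finset YoungDiagram :=
  (level (μ.card - 1)).filter (μ ∈ ·.up)

theorem mem_up {μ ν : YoungDiagram} : ν ∈ μ.up ↔ μ ≤ ν ∧ ν.card = μ.card + 1 := by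
  simp [up, and_comm]

theorem mem_down {μ ν : YoungDiagram} : ν ∈ μ.down ↔ μ ∈ ν.up := by
  simp only [down, Finset.mem_filter, mem_level, and_iff_right_iff_imp, mem_up]
  omega

theorem card_sup_add_card_inf (μ ν : YoungDiagram) :
    (μ ⊔ ν).card + (μ ⊓ ν).card = μ.card + ν.card :=
  Finset.card_union_add_card_inter _ _

theorem eq_of_le_of_card_le {μ ν : YoungDiagram} (h : μ ≤ ν) (hc : ν.card ≤ μ.card) : μ = ν :=
  YoungDiagram.ext (Finset.eq_of_subset_of_card_le h hc)

theorem card_le_card {μ ν : YoungDiagram} (h : μ ≤ ν) : μ.card ≤ ν.card :=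
  Finset.card_le_card h

theorem exists_insert_of_mem_up {μ ν : YoungDiagram} (h : ν ∈ μ.up) :
    ∃ c ∉ μ, insert c μ.cells = ν.cells := by
  obtain ⟨h₁, h₂⟩ := mem_up.1 h
  exact Finset.exists_eq_insert_iff.2 ⟨h₁, h₂.symm⟩

theorem mem_up_of_insert {μ ν : YoungDiagram} {c : ℕ × ℕ} (hc : c ∉ μ)
    (h : insert c μ.cells = ν.cells) : ν ∈ μ.up := by
  obtain ⟨h₁, h₂⟩ := Finset.exists_eq_insert_iff.1 ⟨c, hc, h⟩
  exact mem_up.2 ⟨h₁, h₂.symm⟩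

/-- The rows of `μ` ending in a removable cell. -/
def cornerRows (μ : YoungDiagram) : Finset ℕ :=
  (Finset.range μ.card).filter fun i ↦ μ.rowLen (i + 1) < μ.rowLen i

theorem mem_cornerRows {μ : YoungDiagram} {i : ℕ} :
    i ∈ μ.cornerRows ↔ μ.rowLen (i + 1) < μ.rowLen i := by
  simp only [cornerRows, Finset.mem_filter, Finset.mem_range, and_iff_right_iff_imp]
  intro h
  have := μ.cells_subset_range_product (mem_iff_lt_rowLen.2 (Nat.zero_lt_of_lt h))
  simp only [Finset.mem_product, Finset.mem_range] at this
  exact this.1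

/-- The rows of `μ` to which a cell can be added. -/
def addableRows (μ : YoungDiagram) : Finset ℕ :=
  insert 0 (μ.cornerRows.image Nat.succ)

theorem card_addableRows (μ : YoungDiagram) : μ.addableRows.card = μ.cornerRows.card + 1 := by
  rw [addableRows, Finset.card_insert_of_notMem (by simp),
    Finset.card_image_of_injective _ Nat.succ_injective]

theorem mem_addableRows {μ : YoungDiagram} {i : ℕ} :
    i ∈ μ.addableRows ↔ ∀ k < i, μ.rowLen i < μ.rowLen k := by
  rcases i with _ | i
  · simp [addableRows]
  · simp only [addableRows, Finset.mem_insert, Finset.mem_image, Nat.succ_eq_add_one,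
      Nat.add_right_cancel_iff, exists_eq_right, mem_cornerRows]
    constructor
    · rintro (h | h) k hk
      · omega
      · exact h.trans_le (μ.rowLen_anti k i (by omega))
    · exact fun h ↦ Or.inr (h i (by omega))

/-- The diagram `μ` with a cell added at the end of row `i`. -/
def addCell (μ : YoungDiagram) (i : ℕ) (hi : i ∈ μ.addableRows) : YoungDiagram where
  cells := insert (i, μ.rowLen i) μ.cells
  isLowerSet := by
    rintro ⟨a, b⟩ ⟨a', b'⟩ ⟨ha, hb⟩ h
    simp only [Finset.coe_insert, Set.mem_insert_iff, Finset.mem_coe, mem_cells,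
      Prod.mk.injEq] at h ha hb ⊢
    rcases h with ⟨rfl, rfl⟩ | h
    · rcases ha.eq_or_lt with rfl | ha
      · rw [mem_iff_lt_rowLen]
        omega
      · have := mem_addableRows.1 hi _ ha
        rw [mem_iff_lt_rowLen]
        omega
    · exact Or.inr (μ.up_left_mem ha hb h)

/-- The diagram `μ` with the last cell of row `i` removed. -/
def removeCell (μ : YoungDiagram) (i : ℕ) (hi : i ∈ μ.cornerRows) : YoungDiagram where
  cells := μ.cells.erase (i, μ.rowLen i - 1)
  isLowerSet := by
    rintro ⟨a, b⟩ ⟨a', b'⟩ ⟨ha, hb⟩ h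
    rw [mem_cornerRows] at hi
    simp only [Finset.coe_erase, Set.mem_sdiff, Set.mem_singleton_iff, Finset.mem_coe, mem_cells,
      Prod.mk.injEq] at h ha hb ⊢
    refine ⟨μ.up_left_mem ha hb h.1, ?_⟩
    rintro ⟨rfl, rfl⟩
    obtain ⟨h₁, h₂⟩ := h
    rw [mem_iff_lt_rowLen] at h₁
    rcases ha.eq_or_lt with rfl | ha
    · omega
    · have := μ.rowLen_anti (a' + 1) a ha
      omega

theorem card_up (μ : YoungDiagram) : μ.up.card = μ.cornerRows.card + 1 := by
  rw [← card_addableRows]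
  symm
  refine Finset.card_bij μ.addCell ?_ ?_ ?_
  · exact fun i hi ↦ mem_up_of_insert (c := (i, μ.rowLen i)) (by simp [mem_iff_lt_rowLen]) rfl
  · intro i hi k hk h
    have : (i, μ.rowLen i) ∈ (μ.addCell k hk).cells := by
      rw [← h]
      exact Finset.mem_insert_self _ _
    rcases Finset.mem_insert.1 this with h | h
    · exact (Prod.mk.inj h).1
    · simp [mem_iff_lt_rowLen] at h
  · intro ν hν
    obtain ⟨⟨i, j⟩, hc, h⟩ := exists_insert_of_mem_up hν
    have hmem : ∀ a b, a ≤ i → b ≤ j → (a, b) ≠ (i, j) → (a, b) ∈ μ := by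
      intro a b ha hb hne
      have : (a, b) ∈ ν.cells := ν.up_left_mem ha hb
        (by rw [← mem_cells, ← h]; exact Finset.mem_insert_self _ _)
      rw [← h, Finset.mem_insert] at this
      exact this.resolve_left hne
    have hj : j = μ.rowLen i := by
      rw [mem_iff_lt_rowLen] at hc
      by_contra hne
      have := hmem i (μ.rowLen i) le_rfl (by omega) (by simpa using Ne.symm hne)
      simp [mem_iff_lt_rowLen] at this
    subst hj
    refine ⟨i, mem_addableRows.2 fun k hk ↦ ?_, YoungDiagram.ext h⟩
    exact mem_iff_lt_rowLen.1 (hmem k _ hk.le le_rfl (by simp [hk.ne]))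

theorem card_down (μ : YoungDiagram) : μ.down.card = μ.cornerRows.card := by
  symm
  have hlast : ∀ i ∈ μ.cornerRows, (i, μ.rowLen i - 1) ∈ μ := by
    intro i hi
    rw [mem_cornerRows] at hi
    rw [mem_iff_lt_rowLen]
    omega
  refine Finset.card_bij μ.removeCell ?_ ?_ ?_
  · intro i hi
    exact mem_down.2 (mem_up_of_insert (c := (i, μ.rowLen i - 1))
      (Finset.notMem_erase _ _) (Finset.insert_erase (hlast i hi)))
  · intro i hi k hk h
    have : (i, μ.rowLen i - 1) ∉ (μ.removeCell k hk).cells := by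
      rw [← h]
      exact Finset.notMem_erase _ _
    by_contra hne
    exact this (Finset.mem_erase.2 ⟨by simp [hne], hlast i hi⟩)
  · intro ρ hρ
    obtain ⟨⟨i, j⟩, hc, h⟩ := exists_insert_of_mem_up (mem_down.1 hρ)
    have hij : (i, j) ∈ μ := by
      rw [← mem_cells, ← h]
      exact Finset.mem_insert_self _ _
    have hnot : ∀ a b, i ≤ a → j ≤ b → (a, b) ≠ (i, j) → (a, b) ∉ μ := by
      intro a b ha hb hne hab
      rw [← mem_cells, ← h, Finset.mem_insert] at hab
      exact hc (ρ.up_left_mem ha hb (hab.resolve_left hne))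
    have h₁ := hnot i (j + 1) le_rfl (by omega) (by simp)
    have h₂ := hnot (i + 1) j (by omega) le_rfl (by simp)
    rw [mem_iff_lt_rowLen] at hij h₁ h₂
    refine ⟨i, mem_cornerRows.2 (by omega), YoungDiagram.ext ?_⟩
    have hj : μ.rowLen i - 1 = j := by omega
    simp only [removeCell, hj, ← h]
    exact Finset.erase_insert hc

open Classical in
theorem sum_up_sum_down_erase (μ : YoungDiagram) (f : YoungDiagram → ℕ) :
    ∑ ν ∈ μ.up, ∑ κ ∈ ν.down.erase μ, f κ = ∑ ρ ∈ μ.down, ∑ κ ∈ ρ.up.erase μ, f κ := by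
  rw [Finset.sum_sigma', Finset.sum_sigma']
  have key : ∀ {μ ν κ : YoungDiagram}, μ ≤ ν → κ ≤ ν → ν.card = μ.card + 1 →
      ν.card = κ.card + 1 → κ ≠ μ → μ ⊔ κ = ν ∧ (μ ⊓ κ).card + 1 = μ.card := by
    intro μ ν κ h₁ h₂ h₃ h₄ hne
    have hlt : μ.card < (μ ⊔ κ).card := by
      by_contra hle
      have := eq_of_le_of_card_le (le_sup_left : μ ≤ μ ⊔ κ) (not_lt.1 hle)
      exact hne (eq_of_le_of_card_le (this ▸ le_sup_right) (by omega))
    have := card_sup_add_card_inf μ κ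
    have h := eq_of_le_of_card_le (sup_le h₁ h₂) (by omega)
    exact ⟨h, by rw [h] at this; omega⟩
  have key' : ∀ {μ ρ κ : YoungDiagram}, ρ ≤ μ → ρ ≤ κ → μ.card = ρ.card + 1 →
      κ.card = ρ.card + 1 → κ ≠ μ → μ ⊓ κ = ρ ∧ (μ ⊔ κ).card = μ.card + 1 := by
    intro μ ρ κ h₁ h₂ h₃ h₄ hne
    have hlt : (μ ⊓ κ).card < μ.card := by
      by_contra hle
      have := eq_of_le_of_card_le (inf_le_left : μ ⊓ κ ≤ μ) (not_lt.1 hle)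
      exact hne (eq_of_le_of_card_le (inf_eq_left.1 this) (by omega)).symm
    have := card_sup_add_card_inf μ κ
    have h := eq_of_le_of_card_le (le_inf h₁ h₂) (by omega)
    exact ⟨h.symm, by rw [← h] at this; omega⟩
  refine Finset.sum_nbij' (fun x ↦ ⟨μ ⊓ x.2, x.2⟩) (fun x ↦ ⟨μ ⊔ x.2, x.2⟩) ?_ ?_ ?_ ?_ ?_
  · rintro ⟨ν, κ⟩ h
    simp only [Finset.mem_sigma, Finset.mem_erase, mem_down, mem_up] at h ⊢
    obtain ⟨⟨h₁, h₂⟩, hne, h₃, h₄⟩ := h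
    obtain ⟨h₅, h₆⟩ := key h₁ h₃ h₂ h₄ hne
    exact ⟨⟨inf_le_left, h₆.symm⟩, hne, inf_le_right, by omega⟩
  · rintro ⟨ρ, κ⟩ h
    simp only [Finset.mem_sigma, Finset.mem_erase, mem_down, mem_up] at h ⊢
    obtain ⟨⟨h₁, h₂⟩, hne, h₃, h₄⟩ := h
    obtain ⟨h₅, h₆⟩ := key' h₁ h₃ h₂ h₄ hne
    exact ⟨⟨le_sup_left, h₆⟩, hne, le_sup_right, by omega⟩
  · rintro ⟨ν, κ⟩ h
    simp only [Finset.mem_sigma, Finset.mem_erase, mem_down, mem_up] at h ⊢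
    obtain ⟨⟨h₁, h₂⟩, hne, h₃, h₄⟩ := h
    rw [(key h₁ h₃ h₂ h₄ hne).1]
  · rintro ⟨ρ, κ⟩ h
    simp only [Finset.mem_sigma, Finset.mem_erase, mem_down, mem_up] at h ⊢
    obtain ⟨⟨h₁, h₂⟩, hne, h₃, h₄⟩ := h
    rw [(key' h₁ h₃ h₂ h₄ hne).1]
  · exact fun _ _ ↦ rfl

end YoungDiagram

theorem IsSYT.le {μ : YoungDiagram} {T : ℕ × ℕ → ℕ} (hT : IsSYT μ T) {a b : ℕ × ℕ}
    (hab : a ≤ b) (hb : b ∈ μ) : T a ≤ T b := by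
  obtain ⟨i, j⟩ := a
  obtain ⟨i', j'⟩ := b
  obtain ⟨hi, hj⟩ := Prod.mk_le_mk.1 hab
  calc T (i, j) ≤ T (i', j) := by
        rcases hi.eq_or_lt with rfl | hi
        · rfl
        · exact (hT.2.2.1 i i' j hi (μ.up_left_mem le_rfl hj hb)).le
    _ ≤ T (i', j') := by
        rcases hj.eq_or_lt with rfl | hj
        · rfl
        · exact (hT.2.1 i' j j' hj hb).le

instance finite_isSYT (μ : YoungDiagram) : Finite {T : ℕ × ℕ → ℕ // IsSYT μ T} := by
  refine Finite.of_injective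
    (fun T (c : μ.cells) ↦ (⟨T.1 c, T.2.1.mapsTo c.2⟩ : Set.Icc 1 μ.card)) ?_
  rintro ⟨T, hT⟩ ⟨S, hS⟩ h
  ext c
  by_cases hc : c ∈ μ
  · simpa using congrFun h ⟨c, hc⟩
  · simp [hT.2.2.2 c hc, hS.2.2.2 c hc]

open Classical in
/-- Extend a filling of `ρ` to `μ` by giving the cells of `μ` outside `ρ` the value `μ.card`. -/
noncomputable def extendFilling (μ ρ : YoungDiagram) (T : ℕ × ℕ → ℕ) : ℕ × ℕ → ℕ :=
  fun c ↦ if c ∈ μ ∧ c ∉ ρ then μ.card else T c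

theorem extendFilling_eq_update {μ ρ : YoungDiagram} {c : ℕ × ℕ} (hc : c ∉ ρ)
    (h : insert c ρ.cells = μ.cells) (T : ℕ × ℕ → ℕ) :
    extendFilling μ ρ T = Function.update T c μ.card := by
  ext d
  have hd : d ∈ μ ↔ d = c ∨ d ∈ ρ := by
    rw [← YoungDiagram.mem_cells, ← h, Finset.mem_insert, YoungDiagram.mem_cells]
  by_cases hdc : d = c
  · subst hdc
    simp [extendFilling, hd, hc]
  · simp [extendFilling, hd, hdc]

theorem IsSYT.extendFilling {μ ρ : YoungDiagram} (h : ρ ∈ μ.down) {T : ℕ × ℕ → ℕ}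
    (hT : IsSYT ρ T) : IsSYT μ (extendFilling μ ρ T) := by
  have hup := YoungDiagram.mem_down.1 h
  obtain ⟨hle, hcard⟩ := YoungDiagram.mem_up.1 hup
  obtain ⟨c, hc, hins⟩ := YoungDiagram.exists_insert_of_mem_up hup
  have hmem : ∀ d, d ∈ μ ↔ d = c ∨ d ∈ ρ := fun d ↦ by
    rw [← YoungDiagram.mem_cells, ← hins, Finset.mem_insert, YoungDiagram.mem_cells]
  have hTle : ∀ d, T d ≤ ρ.card := fun d ↦ by
    by_cases hd : d ∈ ρ
    · exact (hT.1.mapsTo hd).2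
    · simp [hT.2.2.2 d hd]
  have hlt : ∀ a b, a < b → b ∈ μ → (b ∈ ρ → T a < T b) →
      Function.update T c μ.card a < Function.update T c μ.card b := by
    intro a b hab hb himp
    by_cases hbc : b = c
    · subst hbc
      rw [Function.update_self, Function.update_of_ne hab.ne]
      have := hTle a
      omega
    · have hbρ := ((hmem b).1 hb).resolve_left hbc
      have hac : a ≠ c := by
        rintro rfl
        exact hc (ρ.isLowerSet hab.le hbρ)
      rw [Function.update_of_ne hbc, Function.update_of_ne hac]
      exact himp hbρ
  rw [extendFilling_eq_update hc hins]
  refine ⟨?_, ?_, ?_, ?_⟩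
  · have hEq : Set.EqOn T (Function.update T c μ.card) ρ.cells := by
      intro d hd
      rw [Function.update_of_ne]
      rintro rfl
      exact hc hd
    have := (hT.1.congr hEq).insert (a := c) (by simp [hcard])
    rw [Function.update_self] at this
    convert this using 1
    · simp [← hins]
    · ext k
      simp only [Set.mem_Icc, Set.mem_insert_iff]
      omega
  · intro i j₁ j₂ hj hb
    exact hlt _ _ (Prod.mk_lt_mk_iff_right.2 hj) hb (hT.2.1 i j₁ j₂ hj)
  · intro i₁ i₂ j hi hb
    exact hlt _ _ (Prod.mk_lt_mk_iff_left.2 hi) hb (hT.2.2.1 i₁ i₂ j hi)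
  · intro d hd
    rw [hmem, not_or] at hd
    rw [Function.update_of_ne hd.1, hT.2.2.2 d hd.2]

theorem IsSYT.extendFilling_pos_lt_iff {μ ρ : YoungDiagram} (h : ρ ∈ μ.down) {T : ℕ × ℕ → ℕ}
    (hT : IsSYT ρ T) (c : ℕ × ℕ) :
    c ∈ ρ ↔ 0 < _root_.extendFilling μ ρ T c ∧ _root_.extendFilling μ ρ T c < μ.card := by
  obtain ⟨hle, hcard⟩ := YoungDiagram.mem_up.1 (YoungDiagram.mem_down.1 h)
  by_cases hc : c ∈ ρ
  · have := hT.1.mapsTo hc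
    simp only [_root_.extendFilling, hc, not_true_eq_false, and_false, if_false, true_iff]
    obtain ⟨h₁, h₂⟩ := this
    omega
  · have := hT.2.2.2 c hc
    simp only [_root_.extendFilling, hc, false_iff]
    split_ifs <;> omega

theorem IsSYT.exists_extendFilling {μ : YoungDiagram} (hμ : μ.card ≠ 0) {T : ℕ × ℕ → ℕ}
    (hT : IsSYT μ T) : ∃ ρ ∈ μ.down, ∃ S, IsSYT ρ S ∧ _root_.extendFilling μ ρ S = T := by
  obtain ⟨c, hc, hTc⟩ := hT.1.surjOn (show μ.card ∈ Set.Icc 1 μ.card from ⟨by omega, le_rfl⟩)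
  let ρ : YoungDiagram :=
    { cells := μ.cells.erase c
      isLowerSet := by
        intro a b hba ha
        simp only [Finset.coe_erase, Set.mem_sdiff, Set.mem_singleton_iff] at ha ⊢
        refine ⟨μ.isLowerSet hba ha.1, ?_⟩
        rintro rfl
        have h₁ := hT.le hba ha.1
        have h₂ := (hT.1.mapsTo ha.1).2
        exact ha.2 (hT.1.injOn ha.1 hc (by omega)) }
  have hins : insert c ρ.cells = μ.cells := Finset.insert_erase hc
  have hcρ : c ∉ ρ := Finset.notMem_erase _ _
  have hup := YoungDiagram.mem_up_of_insert hcρ hins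
  have hcard := (YoungDiagram.mem_up.1 hup).2
  have hmem : ∀ d, d ∈ ρ ↔ d ≠ c ∧ d ∈ μ := fun d ↦ Finset.mem_erase
  have hlt : ∀ a b, a ≤ b → b ∈ ρ → T a < T b →
      Function.update T c 0 a < Function.update T c 0 b := by
    intro a b hab hb hTab
    have hac : a ≠ c := by
      rintro rfl
      exact hcρ (ρ.isLowerSet hab hb)
    rwa [Function.update_of_ne hac, Function.update_of_ne ((hmem b).1 hb).1]
  refine ⟨ρ, YoungDiagram.mem_down.2 hup, Function.update T c 0, ⟨?_, ?_, ?_, ?_⟩, ?_⟩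
  · have hEq : Set.EqOn T (Function.update T c 0) ρ.cells := by
      intro d hd
      rw [Function.update_of_ne ((hmem d).1 hd).1]
    refine Set.BijOn.congr ?_ hEq
    have := hT.1.sdiff_singleton hc
    convert this using 1
    · simp [ρ]
    · ext k
      simp only [Set.mem_Icc, Set.mem_sdiff, Set.mem_singleton_iff, hTc]
      omega
  · intro i j₁ j₂ hj hb
    exact hlt _ _ (Prod.mk_le_mk.2 ⟨le_rfl, hj.le⟩) hb (hT.2.1 i j₁ j₂ hj ((hmem _).1 hb).2)
  · intro i₁ i₂ j hi hb
    exact hlt _ _ (Prod.mk_le_mk.2 ⟨hi.le, le_rfl⟩) hb (hT.2.2.1 i₁ i₂ j hi ((hmem _).1 hb).2)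
  · intro d hd
    by_cases hdc : d = c
    · rw [hdc, Function.update_self]
    · rw [Function.update_of_ne hdc]
      exact hT.2.2.2 d fun h ↦ hd ((hmem d).2 ⟨hdc, h⟩)
  · rw [extendFilling_eq_update hcρ hins, Function.update_idem, ← hTc, Function.update_eq_self]

/-- The branching rule for standard Young tableaux. -/
theorem sum_down_sytCard {μ : YoungDiagram} (hμ : μ.card ≠ 0) :
    ∑ ρ ∈ μ.down, sytCard ρ = sytCard μ := by
  have hbij : Function.Bijective
      (fun x : Σ ρ : μ.down, {T : ℕ × ℕ → ℕ // IsSYT ρ T} ↦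
        (⟨extendFilling μ x.1 x.2.1, x.2.2.extendFilling x.1.2⟩ :
          {T : ℕ × ℕ → ℕ // IsSYT μ T})) := by
    constructor
    · rintro ⟨⟨ρ, hρ⟩, T, hT⟩ ⟨⟨σ, hσ⟩, S, hS⟩ h
      have h : extendFilling μ ρ T = extendFilling μ σ S := congrArg Subtype.val h
      obtain rfl : ρ = σ := SetLike.ext fun c ↦ by
        rw [hT.extendFilling_pos_lt_iff hρ, hS.extendFilling_pos_lt_iff hσ, h]
      obtain rfl : T = S := by
        ext c
        by_cases hc : c ∈ ρ
        · simpa [extendFilling, hc] using congrFun h c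
        · rw [hT.2.2.2 c hc, hS.2.2.2 c hc]
      rfl
    · rintro ⟨T, hT⟩
      obtain ⟨ρ, hρ, S, hS, h⟩ := hT.exists_extendFilling hμ
      exact ⟨⟨⟨ρ, hρ⟩, S, hS⟩, Subtype.ext h⟩
  rw [sytCard, ← Nat.card_eq_of_bijective _ hbij, Nat.card_sigma, ← Finset.sum_coe_sort]
  rfl

theorem sum_up_sytCard (μ : YoungDiagram) :
    ∑ ν ∈ μ.up, sytCard ν = (μ.card + 1) * sytCard μ := by
  classical
  induction hn : μ.card using Nat.strong_induction_on generalizing μ with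
  | _ n ih =>
  subst hn
  have hup : ∑ ν ∈ μ.up, sytCard ν =
      μ.up.card * sytCard μ + ∑ ν ∈ μ.up, ∑ κ ∈ ν.down.erase μ, sytCard κ := by
    rw [← smul_eq_mul, ← Finset.sum_const, ← Finset.sum_add_distrib]
    refine Finset.sum_congr rfl fun ν hν ↦ ?_
    rw [Finset.add_sum_erase _ _ (YoungDiagram.mem_down.2 hν), sum_down_sytCard]
    have := (YoungDiagram.mem_up.1 hν).2
    omega
  have hdown : μ.card * sytCard μ =
      μ.down.card * sytCard μ + ∑ ρ ∈ μ.down, ∑ κ ∈ ρ.up.erase μ, sytCard κ := by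
    have h : μ.card * sytCard μ = ∑ ρ ∈ μ.down, μ.card * sytCard ρ := by
      rw [← Finset.mul_sum]
      rcases eq_or_ne μ.card 0 with h0 | h0
      · simp [h0]
      · rw [sum_down_sytCard h0]
    rw [h, ← smul_eq_mul, ← Finset.sum_const, ← Finset.sum_add_distrib]
    refine Finset.sum_congr rfl fun ρ hρ ↦ ?_
    rw [Finset.add_sum_erase _ _ (YoungDiagram.mem_down.1 hρ)]
    have hcard := (YoungDiagram.mem_up.1 (YoungDiagram.mem_down.1 hρ)).2
    rw [ih ρ.card (by omega) ρ rfl, hcard]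
  rw [hup, YoungDiagram.sum_up_sum_down_erase, YoungDiagram.card_up, ← YoungDiagram.card_down]
  linarith

theorem sytCard_eq_one_of_card_eq_zero {μ : YoungDiagram} (h : μ.card = 0) : sytCard μ = 1 := by
  have hμ : ∀ c, c ∉ μ := fun c hc ↦ by
    rw [Finset.card_eq_zero] at h
    simp [← YoungDiagram.mem_cells, h] at hc
  rw [sytCard, Nat.card_eq_one_iff_unique]
  refine ⟨⟨fun T S ↦ Subtype.ext (funext fun c ↦ ?_)⟩, ⟨⟨fun _ ↦ 0, ?_⟩⟩⟩
  · rw [T.2.2.2.2 c (hμ c), S.2.2.2.2 c (hμ c)]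
  · refine ⟨?_, fun _ _ _ _ hc ↦ (hμ _ hc).elim, fun _ _ _ _ hc ↦ (hμ _ hc).elim, fun _ _ ↦ rfl⟩
    rw [h, Finset.card_eq_zero.1 h]
    simp

theorem sum_level_sytCard_sq (n : ℕ) :
    ∑ μ ∈ YoungDiagram.level n, sytCard μ ^ 2 = n.factorial := by
  induction n with
  | zero =>
    have : YoungDiagram.level 0 = {⊥} := by
      ext μ
      simp [YoungDiagram.ext_iff]
    simp [this, sytCard_eq_one_of_card_eq_zero]
  | succ n ih =>
    calc ∑ ν ∈ YoungDiagram.level (n + 1), sytCard ν ^ 2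
        = ∑ ν ∈ YoungDiagram.level (n + 1), ∑ μ ∈ ν.down, sytCard ν * sytCard μ := by
          refine Finset.sum_congr rfl fun ν hν ↦ ?_
          rw [YoungDiagram.mem_level] at hν
          rw [← Finset.mul_sum, sum_down_sytCard (by omega), sq]
      _ = ∑ μ ∈ YoungDiagram.level n, ∑ ν ∈ μ.up, sytCard ν * sytCard μ := by
          refine Finset.sum_comm' fun ν μ ↦ ?_
          simp only [YoungDiagram.mem_level, YoungDiagram.mem_down, YoungDiagram.mem_up]
          grind
      _ = ∑ μ ∈ YoungDiagram.level n, (n + 1) * sytCard μ ^ 2 := by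
          refine Finset.sum_congr rfl fun μ hμ ↦ ?_
          rw [YoungDiagram.mem_level] at hμ
          rw [← Finset.sum_mul, sum_up_sytCard, hμ]
          ring
      _ = (n + 1).factorial := by
          rw [← Finset.mul_sum, ih, Nat.factorial_succ]

/-- dimension formula: `n! = Σ_{λ ⊢ n} f_λ²`. -/
theorem factorial_eq_sum_sq_sytCard (n : ℕ) (hn : 0 < n) :
    n.factorial = ∑ᶠ l ∈ {l : YoungDiagram | l.card = n}, sytCard l ^ 2 := by
  rw [finsum_mem_eq_finite_toFinset_sum _ (YoungDiagram.finite_setOf_card_eq n)]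
  exact (sum_level_sytCard_sq n).symm
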